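/- For every integer r ≥ 3, there exists n₀ ∈ ℕ such that for all n ≥ n₀ we have C(r,2)·2^n − r² + 2r ≤ g_r(ℤ_n) ≤ C(r,2)·2^n + 2^{−n/(36·log₂ n)}·2^n, where C(r,2) = r(r−1)/2. -/

import Mathlib

/-- An `r`-coloring of `ZMod n` is rainbow 3-AP-free if no 3-AP `(x, y, z)`
(meaning `x + z = 2y` and `y ≠ x`) receives three pairwise distinct colors. -/
def RainbowAPFreeZ {n r : ℕ} (c : ZMod n → Fin r) : Prop :=
  ∀ x y z : ZMod n, x + z = 2 * y → y ≠ x →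
    (c x = c y ∨ c y = c z ∨ c x = c z)

/-- `gZ r n` is the number of rainbow 3-AP-free `r`-colorings of `ZMod n`. -/
noncomputable def gZ (r n : ℕ) : ℕ :=
  Nat.card {c : ZMod n → Fin r // RainbowAPFreeZ c}


open Finset Classical in
/-- Sparse partial functions. -/
noncomputable def Sp (α : Type) [Fintype α] (n : ℕ) [NeZero n] (σ : ℝ) : Finset (ZMod n → Option α) :=
  univ.filter (fun g => ((univ.filter (fun y => g y ≠ none)).card : ℝ) ≤ σ * n)

open Finset Classical in
lemma Sp_sum (α : Type) [Fintype α] (n : ℕ) [NeZero n] (l : ℝ) :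
    ∑ g : ZMod n → Option α, l ^ (univ.filter (fun y => g y ≠ none)).card
      = (1 + Fintype.card α * l) ^ n := by
  have h1 : ∀ g : ZMod n → Option α, l ^ (univ.filter (fun y => g y ≠ none)).card
      = ∏ y, (if g y ≠ none then l else 1) := by
    intro g
    rw [Finset.prod_ite]; simp
  simp_rw [h1]
  have h2 := Finset.prod_univ_sum (κ := fun _ : ZMod n => Option α) (fun _ : ZMod n => (univ : Finset (Option α)))
    (fun _ o => if o ≠ none then l else 1)
  rw [Fintype.piFinset_univ] at h2
  rw [← h2]
  simp [Fintype.sum_option, ZMod.card]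

open Finset Classical in
lemma sparse_count (α : Type) [Fintype α] (ξ : ℝ) (hξ : 0 < ξ) :
    ∃ σ : ℝ, 0 < σ ∧ ∀ (n : ℕ) [NeZero n], ((Sp α n σ).card : ℝ) ≤ (2 : ℝ) ^ (ξ * n) := by
  set A : ℝ := (Fintype.card α : ℝ) with hA
  have hA0 : 0 ≤ A := by positivity
  have h2 : (1 : ℝ) < (2 : ℝ) ^ (ξ / 2) := Real.one_lt_rpow (by norm_num) (by positivity)
  set l : ℝ := min (1 / 2) (((2 : ℝ) ^ (ξ / 2) - 1) / (A + 1)) with hl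
  have hl0 : 0 < l := lt_min (by norm_num) (div_pos (by linarith) (by linarith))
  have hl1 : l < 1 := lt_of_le_of_lt (min_le_left _ _) (by norm_num)
  have hAl : 1 + A * l ≤ (2 : ℝ) ^ (ξ / 2) := by
    have : l ≤ ((2 : ℝ) ^ (ξ / 2) - 1) / (A + 1) := min_le_right _ _
    rw [le_div_iff₀ (by linarith)] at this
    nlinarith
  have hlog : Real.logb 2 l < 0 := Real.logb_neg (by norm_num) hl0 hl1
  refine ⟨(ξ / 2) / (- Real.logb 2 l), div_pos (by positivity) (by linarith), ?_⟩
  intro n _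
  set σ := (ξ / 2) / (- Real.logb 2 l) with hσ
  have hlσ : l ^ (σ * n) = (2 : ℝ) ^ (-(ξ / 2 * n)) := by
    conv_lhs => rw [← Real.rpow_logb (b := 2) (by norm_num) (by norm_num) hl0]
    rw [← Real.rpow_mul (by norm_num)]
    congr 1
    have hne : Real.logb 2 l ≠ 0 := hlog.ne
    rw [hσ]; field_simp
  have h3 : ((Sp α n σ).card : ℝ) * l ^ (σ * n) ≤ (1 + A * l) ^ n := by
    rw [← Sp_sum α n l, ← nsmul_eq_mul]
    refine le_trans (Finset.card_nsmul_le_sum (Sp α n σ) (fun g => l ^ (univ.filter (fun y => g y ≠ none)).card) _ ?_) ?_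
    · intro g hg
      simp only [Sp, mem_filter] at hg
      rw [← Real.rpow_natCast]
      exact Real.rpow_le_rpow_of_exponent_ge hl0 hl1.le hg.2
    · exact Finset.sum_le_sum_of_subset_of_nonneg (subset_univ _) (fun _ _ _ => by positivity)
  have h4 : (1 + A * l) ^ n ≤ (2 : ℝ) ^ (ξ / 2 * n) := by
    rw [Real.rpow_mul (by norm_num), Real.rpow_natCast]
    exact pow_le_pow_left₀ (by positivity) hAl n
  have h5 := h3.trans h4
  rw [hlσ, Real.rpow_neg (by norm_num), ← div_eq_mul_inv, div_le_iff₀ (by positivity),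
    ← Real.rpow_add (by norm_num)] at h5
  have h6 : ξ / 2 * n + ξ / 2 * n = ξ * n := by ring
  rwa [h6] at h5

open Finset Classical in
lemma sample_step {n : ℕ} [NeZero n] {I : Type} (U V : Finset (ZMod n))
    (hUV : ∀ w, ∃ a ∈ U, ∃ b ∈ V, a + b = w) (X : Finset I) (w : I → ZMod n)
    (T : I → Finset (ZMod n)) (η : ℝ) (hT : ∀ i ∈ X, η * n ≤ ((T i).card : ℝ)) :
    ∃ S : Finset (ZMod n), S.card ≤ U.card + V.card ∧
      η * X.card ≤ ((X.filter (fun i => ∃ y ∈ T i, y ∈ S ∧ w i - y ∈ S)).card : ℝ) := by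
  choose a haU b hbV hab using hUV
  let S : ZMod n → Finset (ZMod n) := fun u => U.image (· + u) ∪ V.image (· - u)
  by_contra hcon
  push Not at hcon
  have hS : ∀ u, (S u).card ≤ U.card + V.card := fun u =>
    (card_union_le _ _).trans (Nat.add_le_add card_image_le card_image_le)
  have h1 : ∀ i ∈ X, η * n ≤ ((univ.filter (fun u : ZMod n => a (w i) + u ∈ T i)).card : ℝ) := by
    intro i hi
    refine (hT i hi).trans ?_
    norm_cast
    refine card_le_card_of_injOn (fun y => y - a (w i)) ?_ ?_
    · intro y hy
      simpa using hy
    · intro y _ y' _ h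
      simpa using h
  have h2 : ∑ i ∈ X, η * n ≤ ∑ i ∈ X, ((univ.filter (fun u : ZMod n => a (w i) + u ∈ T i)).card : ℝ) :=
    Finset.sum_le_sum h1
  have h3 : ∑ i ∈ X, (univ.filter (fun u : ZMod n => a (w i) + u ∈ T i)).card
      = ∑ u : ZMod n, (X.filter (fun i => a (w i) + u ∈ T i)).card :=
    Finset.sum_card_bipartiteAbove_eq_sum_card_bipartiteBelow (fun i u => a (w i) + u ∈ T i)
  have h4 : ∀ u : ZMod n, ((X.filter (fun i => a (w i) + u ∈ T i)).card : ℝ) < η * X.card := by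
    intro u
    refine lt_of_le_of_lt ?_ (hcon (S u) (hS u))
    norm_cast
    refine card_le_card ?_
    intro i hi
    simp only [mem_filter] at hi ⊢
    refine ⟨hi.1, _, hi.2, ?_, ?_⟩
    · exact mem_union_left _ (mem_image.2 ⟨_, haU (w i), rfl⟩)
    · refine mem_union_right _ (mem_image.2 ⟨_, hbV (w i), ?_⟩)
      rw [← hab (w i)]
      have := hab (w i)
      simp only [this]
      linear_combination this
  have h5 : ∑ u : ZMod n, ((X.filter (fun i => a (w i) + u ∈ T i)).card : ℝ)
      < ∑ u : ZMod n, η * X.card :=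
    Finset.sum_lt_sum_of_nonempty univ_nonempty (fun u _ => h4 u)
  rw [← Nat.cast_sum, ← h3, Nat.cast_sum] at h5
  have h6 := h2.trans_lt h5
  simp only [sum_const, nsmul_eq_mul, card_univ, ZMod.card] at h6
  linarith [mul_comm (η * X.card) (n : ℝ), h6, show (X.card : ℝ) * (η * n) = n * (η * X.card) by ring]

open Finset Classical in
lemma sample_iter {n : ℕ} [NeZero n] {I : Type} (U V : Finset (ZMod n))
    (hUV : ∀ w, ∃ a ∈ U, ∃ b ∈ V, a + b = w) (X : Finset I) (w : I → ZMod n)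
    (T : I → Finset (ZMod n)) (η : ℝ) (hη : η ≤ 1) (hT : ∀ i ∈ X, η * n ≤ ((T i).card : ℝ)) (k : ℕ) :
    ∃ S : Finset (ZMod n), S.card ≤ k * (U.card + V.card) ∧
      ((X.filter (fun i => ¬ ∃ y ∈ T i, y ∈ S ∧ w i - y ∈ S)).card : ℝ) ≤ (1 - η) ^ k * X.card := by
  induction k with
  | zero => 
    refine ⟨∅, by simp, ?_⟩
    simp
  | succ k ih =>
    obtain ⟨S, hS, hX⟩ := ih
    set X' := X.filter (fun i => ¬ ∃ y ∈ T i, y ∈ S ∧ w i - y ∈ S) with hX'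
    obtain ⟨S', hS', hXnew⟩ := sample_step U V hUV X' w T η (fun i hi => hT i (mem_filter.1 hi).1)
    refine ⟨S ∪ S', ?_, ?_⟩
    · refine (card_union_le _ _).trans ?_
      rw [Nat.succ_mul]; omega
    · have h1 := Finset.card_filter_add_card_filter_not (s := X') (fun i => ∃ y ∈ T i, y ∈ S' ∧ w i - y ∈ S')
      have h2 : (X.filter (fun i => ¬ ∃ y ∈ T i, y ∈ S ∪ S' ∧ w i - y ∈ S ∪ S')).card
          ≤ (X'.filter (fun i => ¬ ∃ y ∈ T i, y ∈ S' ∧ w i - y ∈ S')).card := by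
        refine card_le_card ?_
        intro i hi
        simp only [hX', mem_filter, mem_union] at hi ⊢
        refine ⟨⟨hi.1, ?_⟩, ?_⟩
        · rintro ⟨y, h, h1, h2⟩
          exact hi.2 ⟨y, h, Or.inl h1, Or.inl h2⟩
        · rintro ⟨y, h, h1, h2⟩
          exact hi.2 ⟨y, h, Or.inr h1, Or.inr h2⟩
      have h1' : ((X'.filter (fun i => ∃ y ∈ T i, y ∈ S' ∧ w i - y ∈ S')).card : ℝ) + ((X'.filter (fun i => ¬ ∃ y ∈ T i, y ∈ S' ∧ w i - y ∈ S')).card : ℝ) = X'.card := by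
        exact_mod_cast h1
      have h2' : ((X.filter (fun i => ¬ ∃ y ∈ T i, y ∈ S ∪ S' ∧ w i - y ∈ S ∪ S')).card : ℝ)
          ≤ ((X'.filter (fun i => ¬ ∃ y ∈ T i, y ∈ S' ∧ w i - y ∈ S')).card : ℝ) := by
        exact_mod_cast h2
      calc _ ≤ _ := h2'
        _ ≤ (1 - η) * X'.card := by linarith
        _ ≤ (1 - η) * ((1 - η) ^ k * X.card) := mul_le_mul_of_nonneg_left hX (by linarith)
        _ = _ := by ring

open Finset Classical in
lemma exists_basis {n : ℕ} [NeZero n] (L : ℕ) (hL : n ≤ L * L) :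
    ∃ U V : Finset (ZMod n), U.card ≤ L ∧ V.card ≤ L ∧ ∀ w, ∃ a ∈ U, ∃ b ∈ V, a + b = w := by
  refine ⟨Finset.image (fun i : ℕ => (i : ZMod n)) (range L), Finset.image (fun i : ℕ => ((L * i : ℕ) : ZMod n)) (range L),
    card_image_le.trans (by simp), card_image_le.trans (by simp), ?_⟩
  intro w
  have hw : w.val < L * L := lt_of_lt_of_le (ZMod.val_lt w) hL
  have hL0 : 0 < L := by
    rcases Nat.eq_zero_or_pos L with h | h
    · subst h; simp at hw
    · exact h
  refine ⟨_, mem_image.2 ⟨w.val % L, mem_range.2 (Nat.mod_lt _ hL0), rfl⟩,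
    _, mem_image.2 ⟨w.val / L, mem_range.2 (Nat.div_lt_of_lt_mul hw), rfl⟩, ?_⟩
  rw [← Nat.cast_add, Nat.mod_add_div, ZMod.natCast_zmod_val]

open Finset Classical Filter in
lemma exists_sample (r : ℕ) (η σ : ℝ) (hη : 0 < η) (hη1 : η < 1) (hσ : 0 < σ) :
    ∃ n₀ : ℕ, ∀ (n : ℕ) [NeZero n], n₀ ≤ n → ∀ (T : ZMod n × Fin r × Fin r → Finset (ZMod n)),
      ∃ S : Finset (ZMod n), (S.card : ℝ) ≤ σ * n ∧
        ∀ i, η * n ≤ ((T i).card : ℝ) → ∃ y ∈ T i, y ∈ S ∧ 2 * i.1 - y ∈ S := by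
  have ht := tendsto_pow_const_mul_const_pow_of_abs_lt_one 4 (r := 1 - η) (by rw [abs_lt]; constructor <;> linarith)
  have ht2 : Tendsto (fun s : ℕ => (16 * r ^ 2 : ℝ) * ((s : ℝ) ^ 4 * (1 - η) ^ s)) atTop (nhds 0) := by
    simpa using ht.const_mul (16 * r ^ 2 : ℝ)
  have he := ht2.eventually_lt_const (u := 1) (by norm_num)
  obtain ⟨s₁, hs₁⟩ := eventually_atTop.1 he
  obtain ⟨s₂, hs₂⟩ := exists_nat_ge (8 / σ)
  set s₀ := max (max s₁ s₂) 1 with hs₀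
  refine ⟨(s₀ ^ 2) ^ 2, ?_⟩
  intro n _ hn T
  set m := Nat.sqrt n with hm
  set s := Nat.sqrt m with hs
  have hms : s₀ ^ 2 ≤ m := by rw [hm, Nat.le_sqrt']; exact hn
  have hss : s₀ ≤ s := by rw [hs, Nat.le_sqrt']; exact hms
  have hs1 : 1 ≤ s := le_trans (le_max_right _ _) hss
  have hm1 : s * s ≤ m := Nat.sqrt_le m
  have hm2 : m < (s + 1) * (s + 1) := Nat.lt_succ_sqrt m
  have hn1 : m * m ≤ n := Nat.sqrt_le n
  have hn2 : n < (m + 1) * (m + 1) := Nat.lt_succ_sqrt n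
  obtain ⟨U, V, hU, hV, hUV⟩ := exists_basis (n := n) (m + 1) hn2.le
  obtain ⟨S, hS, hX⟩ := sample_iter U V hUV (univ.filter (fun i => η * n ≤ ((T i).card : ℝ)))
    (fun i => 2 * i.1) T η hη1.le (fun i hi => (mem_filter.1 hi).2) s
  refine ⟨S, ?_, ?_⟩
  · have h1 : S.card ≤ s * (4 * m) := by
      refine hS.trans (Nat.mul_le_mul_left _ ?_)
      have : 1 ≤ m := by nlinarith
      omega
    have h2 : (S.card : ℝ) ≤ s * (4 * m) := by exact_mod_cast h1
    have h3 : (m * m : ℝ) ≤ n := by exact_mod_cast hn1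
    have h4 : (s * s : ℝ) ≤ m := by exact_mod_cast hm1
    have h5 : 8 / σ ≤ s := hs₂.trans (by exact_mod_cast (le_trans (le_trans (le_max_right _ _) (le_max_left _ _)) hss))
    rw [div_le_iff₀ hσ] at h5
    have hs0 : (0 : ℝ) ≤ s := by positivity
    have hm0 : (0 : ℝ) ≤ m := by positivity
    have h6 : (4 * s : ℝ) ≤ σ * m := by nlinarith
    nlinarith
  · have h1 : ((univ.filter (fun i : ZMod n × Fin r × Fin r => η * n ≤ ((T i).card : ℝ))).card : ℝ) ≤ 16 * s ^ 4 * r ^ 2 := by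
      have : (univ.filter (fun i : ZMod n × Fin r × Fin r => η * n ≤ ((T i).card : ℝ))).card ≤ n * (r * r) := by
        refine (card_le_univ _).trans ?_
        simp [Fintype.card_prod, ZMod.card]
      have hn3 : n ≤ 16 * s ^ 4 := by
        have h1 : m + 1 ≤ 4 * (s * s) := by nlinarith
        have h2 := Nat.mul_le_mul h1 h1
        nlinarith
      have := this.trans (Nat.mul_le_mul_right _ hn3)
      calc _ ≤ ((16 * s ^ 4 * (r * r) : ℕ) : ℝ) := by exact_mod_cast this
        _ = _ := by push_cast; ring
    have h2 := hs₁ s (le_trans (le_trans (le_max_left _ _) (le_max_left _ _)) hss)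
    have h3 := hX.trans (mul_le_mul_of_nonneg_left h1 (pow_nonneg (by linarith) _))
    have h4 : (1 - η) ^ s * (16 * (s : ℝ) ^ 4 * (r : ℝ) ^ 2) < 1 := by
      refine lt_of_eq_of_lt ?_ h2; ring
    have h5 := h3.trans_lt h4
    norm_cast at h5
    rw [Nat.lt_one_iff, card_eq_zero] at h5
    intro i hi
    by_contra hcon
    have : i ∈ (∅ : Finset (ZMod n × Fin r × Fin r)) := by
      rw [← h5]
      simp only [mem_filter, mem_univ, true_and]
      exact ⟨hi, hcon⟩
    simp at this

open Finset Classical in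
lemma exists_transversal {n : ℕ} [NeZero n] (t : ZMod n) :
    ∃ R : Finset (ZMod n), R.card * addOrderOf t = n ∧ ∀ y, ∃ i : ℕ, ∃ ρ ∈ R, y = ρ + i • t := by
  refine ⟨Finset.image (fun q : ZMod n ⧸ AddSubgroup.zmultiples t => q.out) univ, ?_, ?_⟩
  · rw [card_image_of_injective _ (fun a b h => by simpa using congrArg (QuotientAddGroup.mk (s := AddSubgroup.zmultiples t)) h)]
    have := AddSubgroup.card_eq_card_quotient_mul_card_addSubgroup (AddSubgroup.zmultiples t)
    rw [Nat.card_zmultiples, Nat.card_zmod] at this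
    rw [card_univ, ← Nat.card_eq_fintype_card]
    exact this.symm
  · intro y
    have h : (QuotientAddGroup.mk (s := AddSubgroup.zmultiples t) (Quotient.out (QuotientAddGroup.mk (s := AddSubgroup.zmultiples t) y))) = QuotientAddGroup.mk y := by simp
    rw [QuotientAddGroup.eq] at h
    have h' := mem_multiples_iff_mem_zmultiples.2 h
    obtain ⟨i, hi⟩ := (AddSubmonoid.mem_multiples_iff _ _).1 h'
    refine ⟨i, _, mem_image.2 ⟨QuotientAddGroup.mk (s := AddSubgroup.zmultiples t) y, mem_univ _, rfl⟩, ?_⟩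
    rw [hi]; abel

open Finset Classical in
/-- Functions with an approximate period of large order. -/
noncomputable def Per (α : Type) [Fintype α] [DecidableEq α] (n : ℕ) [NeZero n] (K : ℕ) (η : ℝ) : Finset (ZMod n → α) :=
  univ.filter (fun f => ∃ t : ZMod n, K ≤ addOrderOf t ∧
    ((univ.filter (fun y => f (y + t) ≠ f y)).card : ℝ) ≤ η * n)

open Finset Classical in
lemma per_count (α : Type) [Fintype α] [DecidableEq α] (n : ℕ) [NeZero n] (K : ℕ) (η σ : ℝ) (hK : 0 < K)
    (h : 1 / K + η ≤ σ) : (Per α n K η).card ≤ n * (Sp α n σ).card := by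
  have hsub : Per α n K η ⊆ (univ : Finset (ZMod n)).biUnion (fun t => univ.filter (fun f =>
      K ≤ addOrderOf t ∧ ((univ.filter (fun y => f (y + t) ≠ f y)).card : ℝ) ≤ η * n)) := by
    intro f hf
    simp only [Per, mem_filter, mem_univ, true_and, mem_biUnion] at hf ⊢
    exact hf
  refine (card_le_card hsub).trans (card_biUnion_le.trans ?_)
  have : ∀ t ∈ (univ : Finset (ZMod n)), (univ.filter (fun f : ZMod n → α =>
      K ≤ addOrderOf t ∧ ((univ.filter (fun y => f (y + t) ≠ f y)).card : ℝ) ≤ η * n)).card ≤ (Sp α n σ).card := by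
    intro t _
    obtain ⟨R, hR, hRt⟩ := exists_transversal t
    refine card_le_card_of_injOn (fun f y => if y ∈ R ∨ f y ≠ f (y - t) then some (f y) else none) ?_ ?_
    · intro f hf
      simp only [coe_filter, mem_univ, true_and, Set.mem_ofPred_eq] at hf
      simp only [Sp, coe_filter, mem_univ, true_and, Set.mem_ofPred_eq]
      have h1 : (univ.filter (fun y => (if y ∈ R ∨ f y ≠ f (y - t) then some (f y) else none) ≠ none))
          ⊆ R ∪ (univ.filter (fun y => f (y + t) ≠ f y)).image (· + t) := by
        intro y hy
        simp only [mem_filter, mem_univ, true_and, ne_eq, ite_eq_right_iff, reduceCtorEq, imp_false,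
          not_not] at hy
        rcases hy with hy | hy
        · exact mem_union_left _ hy
        · refine mem_union_right _ (mem_image.2 ⟨y - t, ?_, by ring⟩)
          simp only [mem_filter, mem_univ, true_and, sub_add_cancel]
          exact hy
      have h2 := (card_le_card h1).trans ((card_union_le _ _).trans (Nat.add_le_add_left card_image_le _))
      have h2' : ((univ.filter (fun y => (if y ∈ R ∨ f y ≠ f (y - t) then some (f y) else none) ≠ none)).card : ℝ)
         ≤ R.card + ((univ.filter (fun y => f (y + t) ≠ f y)).card : ℝ) := by exact_mod_cast h2
      have h3 : (R.card : ℝ) ≤ 1 / K * n := by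
        have : R.card * K ≤ n := by
          calc _ ≤ R.card * addOrderOf t := Nat.mul_le_mul_left _ hf.1
            _ = n := hR
        have : (R.card * K : ℝ) ≤ n := by exact_mod_cast this
        rw [one_div, inv_mul_eq_div, le_div_iff₀ (by exact_mod_cast hK)]
        exact this
      have h4 : (1 / K + η) * n ≤ σ * n := mul_le_mul_of_nonneg_right h (by positivity)
      linarith [hf.2]
    · intro f hf f' hf' hff
      have key : ∀ y, (y ∈ R → f y = f' y) ∧ (f (y - t) = f' (y - t) → f y = f' y) := by
        intro y
        have := congrFun hff y
        simp only at this
        constructor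
        · intro hy
          simpa [hy] using this
        · intro hy
          split_ifs at this with h1 h2 h2
          · simpa using this
          · push Not at h1 h2
            rw [h1.2, h2.2, hy]
      funext y
      obtain ⟨i, ρ, hρ, rfl⟩ := hRt y
      induction i with
      | zero => simpa using (key ρ).1 hρ
      | succ i ih =>
        refine (key _).2 ?_
        have : ρ + (i + 1) • t - t = ρ + i • t := by rw [succ_nsmul]; abel
        rw [this]; exact ih
  refine (Finset.sum_le_sum this).trans ?_
  simp [ZMod.card]

open Finset Classical in
lemma exists_big_order {n : ℕ} [NeZero n] (K : ℕ) (E : Finset (ZMod n)) (hE : 2 * K.factorial < E.card) :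
    ∃ x ∈ E, ∃ x' ∈ E, K < addOrderOf (2 * (x - x')) := by
  obtain ⟨x', hx'⟩ : E.Nonempty := by
    rw [← card_pos]; omega
  by_contra hcon
  push Not at hcon
  have h1 : E.card ≤ (univ.filter (fun z : ZMod n => (2 * K.factorial) • z = 0)).card := by
    refine card_le_card_of_injOn (fun x => x - x') ?_ ?_
    · intro x hx
      simp only [coe_filter, mem_univ, true_and, Set.mem_ofPred_eq]
      have h2 := hcon x hx x' hx'
      have h3 : addOrderOf (2 * (x - x')) ∣ K.factorial :=
        Nat.dvd_factorial (addOrderOf_pos _) h2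
      have h4 := addOrderOf_dvd_iff_nsmul_eq_zero.1 h3
      rw [nsmul_eq_mul] at h4 ⊢
      rw [← h4]; push_cast; ring
    · intro y _ y' _ h
      simpa using h
  have h2 : (univ.filter (fun z : ZMod n => (2 * K.factorial) • z = 0)).card ≤ 2 * K.factorial :=
    IsAddCyclic.card_nsmul_eq_zero_le (by positivity)
  omega

open Finset Classical in
lemma half_card {n : ℕ} [NeZero n] (z : ZMod n) :
    2 * (univ.filter (fun y : ZMod n => y.val ≤ (2 * z - y).val)).card ≤ n + 2 := by
  set R := univ.filter (fun y : ZMod n => y.val ≤ (2 * z - y).val) with hR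
  have h1 := card_union_add_card_inter R (R.image (fun y => 2 * z - y))
  have h2 : (R.image (fun y => 2 * z - y)).card = R.card := by
    refine card_image_of_injective _ ?_
    intro a b h
    simpa using h
  have h3 : (R ∪ R.image (fun y => 2 * z - y)).card ≤ n := by
    refine (card_le_univ _).trans ?_
    rw [ZMod.card]
  have h4 : (R ∩ R.image (fun y => 2 * z - y)).card ≤ 2 := by
    have h5 : (R ∩ R.image (fun y => 2 * z - y)).card ≤ (univ.filter (fun x : ZMod n => 2 • x = 0)).card := by
      refine card_le_card_of_injOn (fun y => z - y) ?_ ?_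
      · intro y hy
        simp only [coe_inter, Set.mem_inter_iff, mem_coe, mem_image, hR, mem_filter, mem_univ, true_and] at hy
        simp only [coe_filter, mem_univ, true_and, Set.mem_ofPred_eq]
        obtain ⟨h6, y', h7, h8⟩ := hy
        have h9 : y' = 2 * z - y := by rw [← h8]; ring
        have h10 : (2 * z - y').val ≤ (2 * z - y).val := by rw [h8]; exact h6
        rw [h9] at h7
        have h11 : 2 * z - (2 * z - y) = y := by ring
        rw [h11] at h7
        have h12 : y = 2 * z - y := ZMod.val_injective n (le_antisymm h6 h7)
        rw [nsmul_eq_mul]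
        push_cast
        linear_combination -h12
      · intro a _ b _ h
        simpa using h
    exact h5.trans (IsAddCyclic.card_nsmul_eq_zero_le (by norm_num))
  omega

lemma rainbow_reflect {n r : ℕ} {c : ZMod n → Fin r} (hc : RainbowAPFreeZ c) (x y : ZMod n)
    (h : c y ≠ c (2 * x - y)) : c x = c y ∨ c x = c (2 * x - y) := by
  have hxy : x ≠ y := by
    rintro rfl
    apply h
    congr 1
    ring
  rcases hc y x (2 * x - y) (by ring) hxy with h1 | h1 | h1
  · exact Or.inl h1.symm
  · exact Or.inr h1
  · exact absurd h1 h

open Finset Classical in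
/-- Colorings in which two colors dominate but a third color occurs. -/
noncomputable def CaseOne (r n : ℕ) [NeZero n] (ε : ℝ) : Finset (ZMod n → Fin r) :=
  univ.filter (fun c => RainbowAPFreeZ c ∧ ∃ (z : ZMod n) (j k : Fin r), c z ≠ j ∧ c z ≠ k ∧
    ((univ.filter (fun y => c y ≠ j ∧ c y ≠ k)).card : ℝ) ≤ ε * n)

open Finset Classical in
lemma case_one_count (r n : ℕ) [NeZero n] (ε σ : ℝ) (h : 2 * ε ≤ σ) :
    (CaseOne r n ε).card ≤ n * (r * r) * ((Sp (Fin r) n σ).card * 2 ^ (n / 2 + 1)) := by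
  have hsub : CaseOne r n ε ⊆ (univ : Finset (ZMod n × Fin r × Fin r)).biUnion (fun p =>
      univ.filter (fun c => RainbowAPFreeZ c ∧ c p.1 ≠ p.2.1 ∧ c p.1 ≠ p.2.2 ∧
        ((univ.filter (fun y => c y ≠ p.2.1 ∧ c y ≠ p.2.2)).card : ℝ) ≤ ε * n)) := by
    intro c hc
    simp only [CaseOne, mem_filter, mem_univ, true_and, mem_biUnion] at hc ⊢
    obtain ⟨h1, z, j, k, h2⟩ := hc
    exact ⟨(z, j, k), h1, h2⟩
  refine (card_le_card hsub).trans (card_biUnion_le.trans ?_)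
  have : ∀ p ∈ (univ : Finset (ZMod n × Fin r × Fin r)),
      (univ.filter (fun c : ZMod n → Fin r => RainbowAPFreeZ c ∧ c p.1 ≠ p.2.1 ∧ c p.1 ≠ p.2.2 ∧
        ((univ.filter (fun y => c y ≠ p.2.1 ∧ c y ≠ p.2.2)).card : ℝ) ≤ ε * n)).card
        ≤ (Sp (Fin r) n σ).card * 2 ^ (n / 2 + 1) := by
    rintro ⟨z, j, k⟩ _
    simp only
    set R := univ.filter (fun y : ZMod n => y.val ≤ (2 * z - y).val) with hR
    set P : Finset (ZMod n → Fin r) := Fintype.piFinset (fun y => if y ∈ R then {j, k} else {j}) with hP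
    have hPc : P.card ≤ 2 ^ (n / 2 + 1) := by
      rw [hP, Fintype.card_piFinset]
      have : ∀ y ∈ (univ : Finset (ZMod n)), (if y ∈ R then ({j, k} : Finset (Fin r)) else {j}).card ≤ if y ∈ R then 2 else 1 := by
        intro y _
        split_ifs
        · exact card_le_two
        · simp
      refine (Finset.prod_le_prod' this).trans ?_
      rw [Finset.prod_ite]
      simp only [prod_const, one_pow, mul_one]
      refine Nat.pow_le_pow_right (by norm_num) ?_
      have := half_card z
      rw [← hR] at this
      have h2 : (univ.filter (fun y => y ∈ R)) = R := by simp
      rw [h2]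
      omega
    refine le_trans ?_ (Nat.mul_le_mul_left _ hPc)
    rw [← card_product]
    refine card_le_card_of_injOn (fun c =>
      (fun y => if (c y ≠ j ∧ c y ≠ k) ∨ (c (2 * z - y) ≠ j ∧ c (2 * z - y) ≠ k) then some (c y) else none,
       fun y => if y ∈ R ∧ (c y = j ∨ c y = k) then c y else j)) ?_ ?_
    · intro c hc
      simp only [coe_filter, mem_univ, true_and, Set.mem_ofPred_eq] at hc
      rw [mem_coe, mem_product]
      constructor
      · simp only [Sp, mem_filter, mem_univ, true_and]
        set B := univ.filter (fun y => c y ≠ j ∧ c y ≠ k) with hB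
        have h1 : (univ.filter (fun y => (if (c y ≠ j ∧ c y ≠ k) ∨ (c (2 * z - y) ≠ j ∧ c (2 * z - y) ≠ k) then some (c y) else none) ≠ none))
          ⊆ B ∪ B.image (fun y => 2 * z - y) := by
          intro y hy
          simp only [mem_filter, mem_univ, true_and, ne_eq, ite_eq_right_iff, reduceCtorEq, imp_false,
            not_not] at hy
          rcases hy with hy | hy
          · exact mem_union_left _ (by simpa [hB] using hy)
          · refine mem_union_right _ (mem_image.2 ⟨2 * z - y, by simpa [hB] using hy, by ring⟩)
        have h2 := (card_le_card h1).trans ((card_union_le _ _).trans (Nat.add_le_add_left card_image_le _))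
        have h2' := (Nat.cast_le (α := ℝ)).2 h2
        push_cast at h2'
        have h3 : 2 * ε * n ≤ σ * n := mul_le_mul_of_nonneg_right h (by positivity)
        linarith [hc.2.2.2]
      · rw [hP, Fintype.mem_piFinset]
        intro y
        by_cases hy : y ∈ R
        · by_cases hy2 : c y = j ∨ c y = k
          · simp [hy, hy2]
          · simp [hy, hy2]
        · simp [hy]
    · intro c hc c' hc' hcc
      simp only [coe_filter, mem_univ, true_and, Set.mem_ofPred_eq] at hc hc'
      simp only [Prod.mk.injEq] at hcc
      obtain ⟨e1, e2⟩ := hcc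
      have e1' := fun y => congrFun e1 y
      have e2' := fun y => congrFun e2 y
      have sym : ∀ (d : ZMod n → Fin r), RainbowAPFreeZ d → d z ≠ j → d z ≠ k → ∀ y,
          (d y = j ∨ d y = k) → (d (2 * z - y) = j ∨ d (2 * z - y) = k) → d y = d (2 * z - y) := by
        intro d hd h1 h2 y h3 h4
        by_contra h5
        rcases rainbow_reflect hd z y h5 with h6 | h6
        · rw [h6] at h1 h2
          exact h3.elim h1 h2
        · rw [h6] at h1 h2
          exact h4.elim h1 h2
      funext y
      have hy := e1' y
      by_cases h1 : (c y ≠ j ∧ c y ≠ k) ∨ (c (2 * z - y) ≠ j ∧ c (2 * z - y) ≠ k)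
      · rw [if_pos h1] at hy
        split_ifs at hy with h2
        simpa using hy
      · rw [if_neg h1] at hy
        split_ifs at hy with h2
        have a1 : c y = j ∨ c y = k := by
          by_contra hq
          rw [not_or] at hq
          exact h1 (Or.inl hq)
        have a2 : c (2 * z - y) = j ∨ c (2 * z - y) = k := by
          by_contra hq
          rw [not_or] at hq
          exact h1 (Or.inr hq)
        have b1 : c' y = j ∨ c' y = k := by
          by_contra hq
          rw [not_or] at hq
          exact h2 (Or.inl hq)
        have b2 : c' (2 * z - y) = j ∨ c' (2 * z - y) = k := by
          by_contra hq
          rw [not_or] at hq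
          exact h2 (Or.inr hq)
        by_cases hyR : y ∈ R
        · have := e2' y
          rw [if_pos ⟨hyR, a1⟩, if_pos ⟨hyR, b1⟩] at this
          exact this
        · have hyR' : 2 * z - y ∈ R := by
            simp only [hR, mem_filter, mem_univ, true_and] at hyR ⊢
            have : 2 * z - (2 * z - y) = y := by ring
            rw [this]; omega
          have := e2' (2 * z - y)
          rw [if_pos ⟨hyR', a2⟩, if_pos ⟨hyR', b2⟩] at this
          rw [sym c hc.1 hc.2.1 hc.2.2.1 y a1 a2, sym c' hc'.1 hc'.2.1 hc'.2.2.1 y b1 b2, this]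
  refine (Finset.sum_le_sum this).trans ?_
  simp [ZMod.card]

open Finset Classical in
/-- Colors available at `x` given a partial coloring `g`. -/
noncomputable def Lst {n r : ℕ} (g : ZMod n → Option (Fin r)) (x : ZMod n) : Finset (Fin r) :=
  univ.filter (fun a => ∀ y j k, g y = some j → g (2 * x - y) = some k → j ≠ k → a = j ∨ a = k)

open Finset Classical in
/-- Available colors once the color class of `i` is known to be `D`. -/
noncomputable def Avail {n r : ℕ} (g : ZMod n → Option (Fin r)) (i : Fin r) (D : ZMod n → Bool)
    (x : ZMod n) : Finset (Fin r) :=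
  if D x = true then {i} else Lst g x

open Finset Classical in
lemma pi_bound {n r : ℕ} [NeZero n] (hr : 1 ≤ r) (F : ZMod n → Finset (Fin r)) (M : ℕ) (d : ℝ)
    (h1 : (univ.filter (fun x => 2 < (F x).card)).card ≤ M)
    (h2 : d ≤ ((univ.filter (fun x => (F x).card ≤ 1)).card : ℝ)) :
    ((Fintype.piFinset F).card : ℝ) ≤ r ^ M * (2 : ℝ) ^ ((n : ℝ) - d) := by
  have h3 : (Fintype.piFinset F).card ≤ r ^ (univ.filter (fun x => 2 < (F x).card)).card *
      2 ^ (univ.filter (fun x => ¬ (F x).card ≤ 1)).card := by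
    rw [Fintype.card_piFinset]
    have : ∀ x ∈ (univ : Finset (ZMod n)), (F x).card ≤
        (if 2 < (F x).card then r else 1) * (if ¬ (F x).card ≤ 1 then 2 else 1) := by
      intro x _
      have : (F x).card ≤ r := by simpa using card_le_univ (F x)
      split_ifs <;> omega
    refine (Finset.prod_le_prod' this).trans ?_
    rw [Finset.prod_mul_distrib, Finset.prod_ite, Finset.prod_ite]
    simp
  have h4 := Finset.card_filter_add_card_filter_not (s := (univ : Finset (ZMod n))) (fun x => (F x).card ≤ 1)
  rw [card_univ, ZMod.card] at h4
  have h4' : ((univ.filter (fun x => (F x).card ≤ 1)).card : ℝ) + ((univ.filter (fun x => ¬ (F x).card ≤ 1)).card : ℝ) = n := by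
    exact_mod_cast h4
  have h5 := (Nat.cast_le (α := ℝ)).2 h3
  push_cast at h5
  refine h5.trans (mul_le_mul ?_ ?_ (by positivity) (by positivity))
  · exact pow_le_pow_right₀ (by exact_mod_cast hr) h1
  · rw [← Real.rpow_natCast]
    apply Real.rpow_le_rpow_of_exponent_le (by norm_num)
    linarith

open Finset Classical in
lemma reflect_period {n : ℕ} [NeZero n] {α : Type} [DecidableEq α] (f : ZMod n → α) (x x' : ZMod n) (e : ℝ)
    (h : ((univ.filter (fun y => f y ≠ f (2 * x - y))).card : ℝ) ≤ e)
    (h' : ((univ.filter (fun y => f y ≠ f (2 * x' - y))).card : ℝ) ≤ e) :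
    ((univ.filter (fun y => f (y + 2 * (x - x')) ≠ f y)).card : ℝ) ≤ 2 * e := by
  have h1 : (univ.filter (fun y => f (y + 2 * (x - x')) ≠ f y)) ⊆
      (univ.filter (fun y => f y ≠ f (2 * x' - y))) ∪
      (univ.filter (fun y => f y ≠ f (2 * x - y))).image (fun y => 2 * x' - y) := by
    intro y hy
    simp only [mem_filter, mem_univ, true_and] at hy
    by_cases hy2 : f y = f (2 * x' - y)
    · refine mem_union_right _ (mem_image.2 ⟨2 * x' - y, ?_, by ring⟩)
      simp only [mem_filter, mem_univ, true_and]
      rw [← hy2, show 2 * x - (2 * x' - y) = y + 2 * (x - x') by ring]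
      exact fun h => hy h.symm
    · exact mem_union_left _ (by simpa using hy2)
  have h2 := (card_le_card h1).trans ((card_union_le _ _).trans (Nat.add_le_add_left card_image_le _))
  have h2' := (Nat.cast_le (α := ℝ)).2 h2
  push_cast at h2'
  linarith

set_option maxHeartbeats 2000000 in
open Finset Classical in
lemma structure_lemma {n r : ℕ} [NeZero n] (hr : 1 ≤ r) (η σ ε δ : ℝ) (K : ℕ)
    (hη : 0 < η) (hε : 0 ≤ ε) (hδ1 : δ ≤ 1 / 2) (hδ2 : δ ≤ ε / r)
    (hsamp : ∀ (T : ZMod n × Fin r × Fin r → Finset (ZMod n)),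
      ∃ S : Finset (ZMod n), (S.card : ℝ) ≤ σ * n ∧
        ∀ i, η * n ≤ ((T i).card : ℝ) → ∃ y ∈ T i, y ∈ S ∧ 2 * i.1 - y ∈ S)
    (hnK : K ≤ n) (hn : 4 * (r * r) * K.factorial ≤ n)
    (c : ZMod n → Fin r) (hc : RainbowAPFreeZ c)
    (hII : ∀ j k, ε * n < ((univ.filter (fun y => c y ≠ j ∧ c y ≠ k)).card : ℝ)) :
    c ∈ Per (Fin r) n K (2 * (r * r * η)) ∨
    ∃ g ∈ Sp (Fin r) n σ, ∃ i, ∃ D ∈ Per Bool n K (2 * (r * r * η)),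
      (∀ x, c x ∈ Avail g i D x) ∧
      (univ.filter (fun x => 2 < (Avail g i D x).card)).card ≤ 2 * K.factorial ∧
      δ * n ≤ ((univ.filter (fun x => (Avail g i D x).card ≤ 1)).card : ℝ) := by
  have hn0 : (0 : ℝ) < n := by exact_mod_cast Nat.pos_of_ne_zero (NeZero.ne n)
  have hr0 : (0 : ℝ) < r := by exact_mod_cast hr
  set T : ZMod n × Fin r × Fin r → Finset (ZMod n) :=
    fun p => univ.filter (fun y => c y = p.2.1 ∧ c (2 * p.1 - y) = p.2.2) with hT
  obtain ⟨S, hS, hST⟩ := hsamp T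
  set pop : ZMod n → Fin r → Fin r → Prop := fun x j k => j ≠ k ∧ η * n ≤ ((T (x, j, k)).card : ℝ) with hpop
  set g : ZMod n → Option (Fin r) := fun y => if y ∈ S then some (c y) else none with hg
  have hgsome : ∀ y j, g y = some j → c y = j := by
    intro y j h
    simp only [hg] at h
    split_ifs at h
    simpa using h
  have hgSp : g ∈ Sp (Fin r) n σ := by
    simp only [Sp, mem_filter, mem_univ, true_and]
    have : (univ.filter (fun y => g y ≠ none)) = S := by
      ext y; simp [hg]
    rw [this]; exact hS
  have hcL : ∀ x, c x ∈ Lst g x := by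
    intro x
    simp only [Lst, mem_filter, mem_univ, true_and]
    intro y j k h1 h2 hjk
    have h1 := hgsome _ _ h1
    have h2 := hgsome _ _ h2
    subst h1; subst h2
    exact rainbow_reflect hc x y hjk
  have hL : ∀ x j k, pop x j k → ∀ a ∈ Lst g x, a = j ∨ a = k := by
    intro x j k ⟨hjk, h1⟩ a ha
    simp only [Lst, mem_filter, mem_univ, true_and] at ha
    obtain ⟨y, hy, hyS, hyS'⟩ := hST _ h1
    simp only [hT, mem_filter, mem_univ, true_and] at hy
    refine ha y j k ?_ ?_ hjk
    · simp [hg, hyS, hy.1]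
    · simp only at hyS'
      simp [hg, hyS', hy.2]
  have herr : ∀ x, ((univ.filter (fun y => c y ≠ c (2 * x - y) ∧ ¬ pop x (c y) (c (2 * x - y)))).card : ℝ) ≤ r * r * η * n := by
    intro x
    have h1 : (univ.filter (fun y => c y ≠ c (2 * x - y) ∧ ¬ pop x (c y) (c (2 * x - y)))) ⊆
        (univ.filter (fun p : Fin r × Fin r => ((T (x, p.1, p.2)).card : ℝ) ≤ η * n)).biUnion (fun p => T (x, p.1, p.2)) := by
      intro y hy
      simp only [mem_filter, mem_univ, true_and, hpop, not_and, not_le] at hy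
      rw [mem_biUnion]
      refine ⟨(c y, c (2 * x - y)), ?_, ?_⟩
      · simp only [mem_filter, mem_univ, true_and]
        exact (hy.2 hy.1).le
      · simp [hT]
    have h2 := (Nat.cast_le (α := ℝ)).2 ((card_le_card h1).trans card_biUnion_le)
    refine h2.trans ?_
    push_cast
    have h3 : ∀ p ∈ (univ.filter (fun p : Fin r × Fin r => ((T (x, p.1, p.2)).card : ℝ) ≤ η * n)), ((T (x, p.1, p.2)).card : ℝ) ≤ η * n := by
      intro p hp
      exact (mem_filter.1 hp).2
    refine (Finset.sum_le_card_nsmul _ _ _ h3).trans ?_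
    rw [nsmul_eq_mul]
    have h4 : ((univ.filter (fun p : Fin r × Fin r => ((T (x, p.1, p.2)).card : ℝ) ≤ η * n)).card : ℝ) ≤ r * r := by
      have := card_le_univ (univ.filter (fun p : Fin r × Fin r => ((T (x, p.1, p.2)).card : ℝ) ≤ η * n))
      simp only [Fintype.card_prod, Fintype.card_fin] at this
      exact_mod_cast this
    calc _ ≤ (r * r : ℝ) * (η * n) := mul_le_mul_of_nonneg_right h4 (by positivity)
      _ = _ := by ring
  set Q := univ.filter (fun x => ∀ j k, ¬ pop x j k) with hQ
  by_cases hQc : 2 * K.factorial < Q.card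
  · left
    obtain ⟨x, hx, x', hx', ht⟩ := exists_big_order K Q hQc
    simp only [Per, mem_filter, mem_univ, true_and]
    refine ⟨_, ht.le, ?_⟩
    have hQe : ∀ x ∈ Q, ((univ.filter (fun y => c y ≠ c (2 * x - y))).card : ℝ) ≤ r * r * η * n := by
      intro x hx
      refine le_trans ?_ (herr x)
      norm_cast
      refine card_le_card ?_
      intro y hy
      simp only [hQ, mem_filter, mem_univ, true_and] at hx hy ⊢
      exact ⟨hy, hx _ _⟩
    refine (reflect_period c x x' _ (hQe x hx) (hQe x' hx')).trans_eq ?_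
    ring
  right
  push Not at hQc
  have hLQ : ∀ x, 2 < (Lst g x).card → x ∈ Q := by
    intro x hx
    simp only [hQ, mem_filter, mem_univ, true_and]
    intro j k hjk
    have : Lst g x ⊆ {j, k} := by
      intro a ha
      simpa using hL x j k hjk a ha
    have := (card_le_card this).trans card_le_two
    omega
  have hAQ : ∀ i D, (univ.filter (fun x => 2 < (Avail g i D x).card)).card ≤ 2 * K.factorial := by
    intro i D
    refine le_trans (card_le_card ?_) hQc
    intro x hx
    have hx := (mem_filter.1 hx).2
    unfold Avail at hx
    split_ifs at hx with h
    · simp at hx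
    · exact hLQ x hx
  set W := univ.filter (fun x => (Lst g x).card ≤ 1) with hW
  by_cases hWc : (1 / 2 : ℝ) * n ≤ W.card
  · refine ⟨g, hgSp, ⟨0, hr⟩, fun _ => false, ?_, ?_, hAQ _ _, ?_⟩
    · simp only [Per, mem_filter, mem_univ, true_and]
      refine ⟨1, by rw [ZMod.addOrderOf_one]; exact hnK, ?_⟩
      simp
      positivity
    · intro x
      simpa [Avail] using hcL x
    · have : (univ.filter (fun x => (Avail g ⟨0, hr⟩ (fun _ => false) x).card ≤ 1)) = W := by
        ext x; simp [Avail, hW]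
      rw [this]
      refine le_trans ?_ hWc
      exact mul_le_mul_of_nonneg_right hδ1 hn0.le
  push Not at hWc
  set E : Fin r × Fin r → Finset (ZMod n) := fun p => univ.filter (fun x =>
    ∀ j' k', pop x j' k' → (p.1 = j' ∨ p.1 = k') ∧ (p.2 = j' ∨ p.2 = k') ∧ p.1 ≠ p.2) with hE
  have hEW : Wᶜ ⊆ (univ : Finset (Fin r × Fin r)).biUnion E := by
    intro x hx
    simp only [hW, mem_compl, mem_filter, mem_univ, true_and, not_le] at hx
    obtain ⟨j, hj, k, hk, hjk⟩ := one_lt_card.1 hx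
    rw [mem_biUnion]
    refine ⟨(j, k), mem_univ _, ?_⟩
    simp only [hE, mem_filter, mem_univ, true_and]
    intro j' k' hp
    exact ⟨hL x _ _ hp j hj, hL x _ _ hp k hk, hjk⟩
  have hEbig : ∃ p, 2 * K.factorial < (E p).card := by
    by_contra hcon
    push Not at hcon
    have h1 := (card_le_card hEW).trans (card_biUnion_le.trans (Finset.sum_le_card_nsmul univ _ _ (fun p _ => hcon p)))
    simp only [smul_eq_mul, card_univ, Fintype.card_prod, Fintype.card_fin] at h1
    rw [card_compl, ZMod.card] at h1
    have h2 : n ≤ r * r * (2 * K.factorial) + W.card := by omega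
    have h3 : (n : ℝ) ≤ r * r * (2 * K.factorial) + W.card := by exact_mod_cast h2
    have h4 : (4 * (r * r) * K.factorial : ℝ) ≤ n := by exact_mod_cast hn
    linarith
  obtain ⟨⟨j, k⟩, hjk⟩ := hEbig
  obtain ⟨x, hx, x', hx', ht⟩ := exists_big_order K _ hjk
  have hi : ∃ i, i ≠ j ∧ i ≠ k ∧ ε / r * n ≤ ((univ.filter (fun y => c y = i)).card : ℝ) := by
    by_contra hcon
    push Not at hcon
    have h1 : (univ.filter (fun y => c y ≠ j ∧ c y ≠ k)) ⊆
        (univ.filter (fun i : Fin r => i ≠ j ∧ i ≠ k)).biUnion (fun i => univ.filter (fun y => c y = i)) := by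
      intro y hy
      rw [mem_biUnion]
      exact ⟨c y, by simpa using hy, by simp⟩
    have h2 := (Nat.cast_le (α := ℝ)).2 ((card_le_card h1).trans card_biUnion_le)
    push_cast at h2
    have h3 : ∑ i ∈ (univ.filter (fun i : Fin r => i ≠ j ∧ i ≠ k)), ((univ.filter (fun y => c y = i)).card : ℝ)
        ≤ ∑ i ∈ (univ.filter (fun i : Fin r => i ≠ j ∧ i ≠ k)), ε / r * n := by
      refine Finset.sum_le_sum ?_
      intro i hi
      simp only [mem_filter, mem_univ, true_and] at hi
      exact (hcon i hi.1 hi.2).le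
    have h4 := (hII j k).trans_le (h2.trans h3)
    rw [sum_const, nsmul_eq_mul] at h4
    have h5 : ((univ.filter (fun i : Fin r => i ≠ j ∧ i ≠ k)).card : ℝ) ≤ r := by
      have := card_le_univ (univ.filter (fun i : Fin r => i ≠ j ∧ i ≠ k))
      rw [Fintype.card_fin] at this
      exact_mod_cast this
    have h6 : ((univ.filter (fun i : Fin r => i ≠ j ∧ i ≠ k)).card : ℝ) * (ε / r * n) ≤ r * (ε / r * n) :=
      mul_le_mul_of_nonneg_right h5 (by positivity)
    have h7 : r * (ε / r * n) = ε * n := by field_simp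
    linarith
  obtain ⟨i, hij, hik, hic⟩ := hi
  refine ⟨g, hgSp, i, fun y => decide (c y = i), ?_, ?_, hAQ _ _, ?_⟩
  · simp only [Per, mem_filter, mem_univ, true_and]
    refine ⟨_, ht.le, ?_⟩
    have hEe : ∀ x ∈ E (j, k), ((univ.filter (fun y => decide (c y = i) ≠ decide (c (2 * x - y) = i))).card : ℝ) ≤ r * r * η * n := by
      intro x hx
      refine le_trans ?_ (herr x)
      norm_cast
      refine card_le_card ?_
      intro y hy
      simp only [hE, mem_filter, mem_univ, true_and] at hx hy ⊢
      refine ⟨?_, ?_⟩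
      · intro h; rw [h] at hy; exact hy rfl
      · intro hp
        obtain ⟨h1, h2, h3⟩ := hx _ _ hp
        apply hy
        have key : ∀ u v : Fin r, (j = u ∨ j = v) → (k = u ∨ k = v) → j ≠ k → u ≠ i ∧ v ≠ i := by
          rintro u v (rfl | rfl) (rfl | rfl) hne
          · exact absurd rfl hne
          · exact ⟨hij.symm, hik.symm⟩
          · exact ⟨hik.symm, hij.symm⟩
          · exact absurd rfl hne
        obtain ⟨e1, e2⟩ := key _ _ h1 h2 h3
        simp [e1, e2]
    refine (reflect_period (fun y => decide (c y = i)) x x' _ (hEe x hx) (hEe x' hx')).trans_eq ?_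
    ring
  · intro x
    by_cases h : c x = i
    · simp [Avail, h]
    · simpa [Avail, h] using hcL x
  · calc δ * n ≤ ε / r * n := mul_le_mul_of_nonneg_right hδ2 hn0.le
      _ ≤ _ := hic
      _ ≤ _ := by
        norm_cast
        refine card_le_card ?_
        intro x hx
        simp only [mem_filter, mem_univ, true_and] at hx ⊢
        simp [Avail, hx]

open Finset Classical in
/-- Rainbow-free colorings with at least three colors. -/
noncomputable def Bad (r n : ℕ) [NeZero n] : Finset (ZMod n → Fin r) :=
  univ.filter (fun c => RainbowAPFreeZ c ∧ ∀ j k, ∃ z, c z ≠ j ∧ c z ≠ k)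

open Finset Classical in
/-- Colorings captured by a sparse certificate with few extensions. -/
noncomputable def Cert (r n : ℕ) [NeZero n] (σ η δ : ℝ) (K : ℕ) : Finset (ZMod n → Fin r) :=
  (((Sp (Fin r) n σ) ×ˢ ((univ : Finset (Fin r)) ×ˢ Per Bool n K η)).filter (fun p =>
      (univ.filter (fun x => 2 < (Avail p.1 p.2.1 p.2.2 x).card)).card ≤ 2 * K.factorial ∧
      δ * n ≤ ((univ.filter (fun x => (Avail p.1 p.2.1 p.2.2 x).card ≤ 1)).card : ℝ))).biUnion
    (fun p => Fintype.piFinset (Avail p.1 p.2.1 p.2.2))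

open Finset Classical in
lemma cert_count {r n : ℕ} [NeZero n] (hr : 1 ≤ r) (σ η δ : ℝ) (K : ℕ) :
    ((Cert r n σ η δ K).card : ℝ) ≤ (Sp (Fin r) n σ).card * (r * (Per Bool n K η).card) *
      (r ^ (2 * K.factorial) * (2 : ℝ) ^ ((n : ℝ) - δ * n)) := by
  unfold Cert
  refine ((Nat.cast_le (α := ℝ)).2 card_biUnion_le).trans ?_
  push_cast
  refine (Finset.sum_le_card_nsmul _ _ (r ^ (2 * K.factorial) * (2 : ℝ) ^ ((n : ℝ) - δ * n)) ?_).trans ?_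
  · intro p hp
    have hp := (mem_filter.1 hp).2
    exact pi_bound hr _ _ _ hp.1 hp.2
  · rw [nsmul_eq_mul]
    refine mul_le_mul_of_nonneg_right ?_ (by positivity)
    have := card_filter_le ((Sp (Fin r) n σ) ×ˢ ((univ : Finset (Fin r)) ×ˢ Per Bool n K η)) (fun p =>
      (univ.filter (fun x => 2 < (Avail p.1 p.2.1 p.2.2 x).card)).card ≤ 2 * K.factorial ∧
      δ * n ≤ ((univ.filter (fun x => (Avail p.1 p.2.1 p.2.2 x).card ≤ 1)).card : ℝ))
    rw [card_product, card_product, card_univ, Fintype.card_fin] at this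
    exact_mod_cast this

open Finset Classical Filter in
lemma bad_count (r : ℕ) (hr : 1 ≤ r) : ∃ δ : ℝ, 0 < δ ∧ ∃ n₀ : ℕ, ∀ (n : ℕ) [NeZero n], n₀ ≤ n →
    ((Bad r n).card : ℝ) ≤ (2 : ℝ) ^ ((1 - δ) * n) := by
  have hr0 : (0 : ℝ) < r := by exact_mod_cast hr
  obtain ⟨σ₁, hσ₁, hS₁⟩ := sparse_count (Fin r) (1 / 8) (by norm_num)
  set ε := σ₁ / 2 with hε
  have hε0 : 0 < ε := by positivity
  set δ := min (1 / 2) (ε / r) with hδ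
  have hδ0 : 0 < δ := lt_min (by norm_num) (by positivity)
  have hδ1 : δ ≤ 1 / 2 := min_le_left _ _
  obtain ⟨σ₂, hσ₂, hS₂⟩ := sparse_count (Fin r) (δ / 8) (by positivity)
  obtain ⟨σ₃, hσ₃, hS₃⟩ := sparse_count Bool (δ / 8) (by positivity)
  set σ₄ := min σ₂ σ₃ with hσ₄
  have hσ₄0 : 0 < σ₄ := lt_min hσ₂ hσ₃
  set η := min (1 / 2) (σ₄ / (4 * (r * r))) with hη
  have hη0 : 0 < η := lt_min (by norm_num) (by positivity)
  have hη1 : η < 1 := (min_le_left _ _).trans_lt (by norm_num)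
  have hη2 : 2 * (r * r * η) ≤ σ₄ / 2 := by
    have : η ≤ σ₄ / (4 * (r * r)) := min_le_right _ _
    rw [le_div_iff₀ (by positivity)] at this
    linarith
  obtain ⟨K, hK⟩ := exists_nat_gt (2 / σ₄)
  have hK0 : (0 : ℝ) < K := lt_trans (by positivity) hK
  have hK0' : 0 < K := by exact_mod_cast hK0
  have hK1 : 1 / (K : ℝ) ≤ σ₄ / 2 := by
    rw [div_lt_iff₀ hσ₄0] at hK
    rw [div_le_iff₀ hK0]
    linarith
  obtain ⟨n₁, hn₁⟩ := exists_sample r η σ₂ hη0 hη1 hσ₂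
  set C : ℝ := 2 * (r * r) + 1 + r * r ^ (2 * K.factorial) with hC
  have hC0 : 0 < C := by positivity
  have hlim : ∀ᶠ n : ℕ in atTop, C * ((n : ℝ) * ((2 : ℝ) ^ (-(δ / 4))) ^ n) < 1 := by
    have h1 := tendsto_self_mul_const_pow_of_lt_one (r := (2 : ℝ) ^ (-(δ / 4))) (by positivity)
      (Real.rpow_lt_one_of_one_lt_of_neg (by norm_num) (by linarith))
    have h2 := h1.const_mul C
    rw [mul_zero] at h2
    exact h2.eventually_lt_const (by norm_num)
  obtain ⟨n₂, hn₂⟩ := eventually_atTop.1 hlim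
  refine ⟨δ / 2, by positivity, max (max n₁ n₂) (max K (4 * (r * r) * K.factorial)), ?_⟩
  intro n _ hn
  simp only [max_le_iff] at hn
  obtain ⟨⟨hnn1, hnn2⟩, hnK, hnr⟩ := hn
  have hn0 : (0 : ℝ) < n := by exact_mod_cast Nat.pos_of_ne_zero (NeZero.ne n)
  have hsub : Bad r n ⊆ CaseOne r n ε ∪ (Per (Fin r) n K (2 * (r * r * η)) ∪ Cert r n σ₂ (2 * (r * r * η)) δ K) := by
    intro c hc
    simp only [Bad, mem_filter, mem_univ, true_and] at hc
    by_cases hII : ∀ j k, ε * n < ((univ.filter (fun y => c y ≠ j ∧ c y ≠ k)).card : ℝ)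
    · refine mem_union_right _ ?_
      rcases structure_lemma hr η σ₂ ε δ K hη0 hε0.le hδ1 (min_le_right _ _) (hn₁ n hnn1) hnK hnr c hc.1 hII with h | h
      · exact mem_union_left _ h
      · refine mem_union_right _ ?_
        obtain ⟨g, hg, i, D, hD, h1, h2, h3⟩ := h
        unfold Cert
        rw [mem_biUnion]
        refine ⟨(g, i, D), ?_, Fintype.mem_piFinset.2 h1⟩
        rw [mem_filter]
        exact ⟨mem_product.2 ⟨hg, mem_product.2 ⟨mem_univ _, hD⟩⟩, h2, h3⟩
    · push Not at hII
      obtain ⟨j, k, hjk⟩ := hII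
      obtain ⟨z, hz⟩ := hc.2 j k
      refine mem_union_left _ ?_
      simp only [CaseOne, mem_filter, mem_univ, true_and]
      exact ⟨hc.1, z, j, k, hz.1, hz.2, hjk⟩
  have hcard : ((Bad r n).card : ℝ) ≤ (CaseOne r n ε).card + ((Per (Fin r) n K (2 * (r * r * η))).card
      + (Cert r n σ₂ (2 * (r * r * η)) δ K).card) := by
    exact_mod_cast (card_le_card hsub).trans ((card_union_le _ _).trans (Nat.add_le_add_left (card_union_le _ _) _))
  set Z : ℝ := (2 : ℝ) ^ ((1 - 3 / 4 * δ) * n) with hZ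
  have b1 : ((CaseOne r n ε).card : ℝ) ≤ 2 * (r * r) * (n * Z) := by
    have h1 := (Nat.cast_le (α := ℝ)).2 (case_one_count r n ε σ₁ (by rw [hε]; linarith))
    push_cast at h1
    refine h1.trans ?_
    have h2 : (2 : ℝ) ^ (n / 2 + 1) ≤ 2 * (2 : ℝ) ^ ((1 / 2 : ℝ) * n) := by
      rw [pow_succ, mul_comm]
      refine mul_le_mul_of_nonneg_left ?_ (by norm_num)
      rw [← Real.rpow_natCast]
      apply Real.rpow_le_rpow_of_exponent_le (by norm_num)
      have : ((n / 2 : ℕ) : ℝ) ≤ (n : ℝ) / 2 := Nat.cast_div_le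
      linarith
    have h3 : ((Sp (Fin r) n σ₁).card : ℝ) * (2 : ℝ) ^ (n / 2 + 1) ≤ 2 * Z := by
      calc _ ≤ (2 : ℝ) ^ ((1 / 8 : ℝ) * n) * (2 * (2 : ℝ) ^ ((1 / 2 : ℝ) * n)) :=
            mul_le_mul (hS₁ n) h2 (by positivity) (by positivity)
        _ = 2 * (2 : ℝ) ^ ((1 / 8 : ℝ) * n + (1 / 2 : ℝ) * n) := by
            rw [Real.rpow_add (by norm_num)]; ring
        _ ≤ 2 * Z := by
            refine mul_le_mul_of_nonneg_left ?_ (by norm_num)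
            apply Real.rpow_le_rpow_of_exponent_le (by norm_num)
            nlinarith
    calc _ ≤ (n * (r * r) : ℝ) * (2 * Z) := mul_le_mul_of_nonneg_left h3 (by positivity)
      _ = _ := by ring
  have b2 : ((Per (Fin r) n K (2 * (r * r * η))).card : ℝ) ≤ n * Z := by
    have h1 := (Nat.cast_le (α := ℝ)).2 (per_count (Fin r) n K (2 * (r * r * η)) σ₂ hK0'
      (by linarith [min_le_left σ₂ σ₃]))
    push_cast at h1
    refine h1.trans (mul_le_mul_of_nonneg_left ((hS₂ n).trans ?_) hn0.le)
    apply Real.rpow_le_rpow_of_exponent_le (by norm_num)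
    nlinarith
  have b3 : ((Cert r n σ₂ (2 * (r * r * η)) δ K).card : ℝ) ≤ r * r ^ (2 * K.factorial) * (n * Z) := by
    refine (cert_count hr _ _ _ _).trans ?_
    have h1 := (Nat.cast_le (α := ℝ)).2 (per_count Bool n K (2 * (r * r * η)) σ₃ hK0'
      (by linarith [min_le_right σ₂ σ₃]))
    push_cast at h1
    have h2 := h1.trans (mul_le_mul_of_nonneg_left (hS₃ n) hn0.le)
    have hZ' : Z = (2 : ℝ) ^ (δ / 8 * n) * (2 : ℝ) ^ (δ / 8 * n) * (2 : ℝ) ^ ((n : ℝ) - δ * n) := by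
      rw [hZ, ← Real.rpow_add (by norm_num), ← Real.rpow_add (by norm_num)]
      congr 1; ring
    calc _ ≤ (2 : ℝ) ^ (δ / 8 * n) * (r * (n * (2 : ℝ) ^ (δ / 8 * n))) *
      (r ^ (2 * K.factorial) * (2 : ℝ) ^ ((n : ℝ) - δ * n)) := by
          refine mul_le_mul_of_nonneg_right ?_ (by positivity)
          exact mul_le_mul (hS₂ n) (mul_le_mul_of_nonneg_left h2 hr0.le) (by positivity) (by positivity)
      _ = _ := by rw [hZ']; ring
  have hfin : ((Bad r n).card : ℝ) ≤ C * (n * Z) := by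
    calc _ ≤ _ := hcard
      _ ≤ 2 * (r * r) * (n * Z) + (n * Z + r * r ^ (2 * K.factorial) * (n * Z)) := by linarith
      _ = _ := by rw [hC]; ring
  have h4 := hn₂ n hnn2
  have h5 : Z = ((2 : ℝ) ^ (-(δ / 4))) ^ n * (2 : ℝ) ^ ((1 - δ / 2) * n) := by
    rw [← Real.rpow_natCast, ← Real.rpow_mul (by norm_num), ← Real.rpow_add (by norm_num), hZ]
    congr 1; ring
  calc _ ≤ _ := hfin
    _ = C * ((n : ℝ) * ((2 : ℝ) ^ (-(δ / 4))) ^ n) * (2 : ℝ) ^ ((1 - δ / 2) * n) := by rw [h5]; ring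
    _ ≤ 1 * (2 : ℝ) ^ ((1 - δ / 2) * n) := mul_le_mul_of_nonneg_right h4.le (by positivity)
    _ = _ := one_mul _

open Finset Classical in
lemma few_upper (r n : ℕ) (hr : 2 ≤ r) [NeZero n] :
    (univ.filter (fun c : ZMod n → Fin r => ∃ j k, ∀ z, c z = j ∨ c z = k)).card ≤ r.choose 2 * 2 ^ n := by
  have hsub : (univ.filter (fun c : ZMod n → Fin r => ∃ j k, ∀ z, c z = j ∨ c z = k)) ⊆
      (powersetCard 2 (univ : Finset (Fin r))).biUnion (fun s => Fintype.piFinset (fun _ => s)) := by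
    intro c hc
    simp only [mem_filter, mem_univ, true_and] at hc
    obtain ⟨j, k, h⟩ := hc
    obtain ⟨s, hs, hsc⟩ := Finset.exists_superset_card_eq (s := ({j, k} : Finset (Fin r))) (n := 2) card_le_two (by simpa using hr)
    rw [mem_biUnion]
    refine ⟨s, mem_powersetCard.2 ⟨subset_univ _, hsc⟩, Fintype.mem_piFinset.2 (fun z => hs ?_)⟩
    simpa using h z
  refine (card_le_card hsub).trans (card_biUnion_le.trans ((Finset.sum_le_card_nsmul _ _ (2 ^ n) ?_).trans ?_))
  · intro s hs
    rw [Fintype.card_piFinset, prod_const, (mem_powersetCard.1 hs).2, card_univ, ZMod.card]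
  · rw [card_powersetCard, card_univ, Fintype.card_fin, smul_eq_mul]

open Finset Classical in
lemma few_lower (r n : ℕ) [NeZero n] :
    r.choose 2 * (2 ^ n - 2) + r ≤
      (univ.filter (fun c : ZMod n → Fin r => ∃ j k, ∀ z, c z = j ∨ c z = k)).card := by
  set A : Finset (Fin r) → Finset (ZMod n → Fin r) := fun s =>
    (Fintype.piFinset (fun _ => s)) \ (s.image (fun j => fun _ : ZMod n => j)) with hA
  set cst : Finset (ZMod n → Fin r) := univ.image (fun j : Fin r => fun _ : ZMod n => j) with hcst
  have hAcard : ∀ s ∈ powersetCard 2 (univ : Finset (Fin r)), 2 ^ n - 2 ≤ (A s).card := by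
    intro s hs
    have h1 := le_card_sdiff (s.image (fun j => fun _ : ZMod n => j)) (Fintype.piFinset (fun _ : ZMod n => s))
    rw [Fintype.card_piFinset, prod_const, (mem_powersetCard.1 hs).2, card_univ, ZMod.card] at h1
    have h2 : (s.image (fun j => fun _ : ZMod n => j)).card ≤ 2 := card_image_le.trans (mem_powersetCard.1 hs).2.le
    refine le_trans ?_ h1
    omega
  have hnc : ∀ s c, c ∈ A s → ∃ z z', c z ≠ c z' := by
    intro s c hc
    by_contra hcon
    push Not at hcon
    simp only [hA, mem_sdiff, Fintype.mem_piFinset, mem_image, not_exists, not_and] at hc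
    exact hc.2 (c 0) (hc.1 0) (funext (fun z => hcon 0 z))
  have hdisj : ∀ s ∈ powersetCard 2 (univ : Finset (Fin r)), ∀ s' ∈ powersetCard 2 (univ : Finset (Fin r)),
      s ≠ s' → Disjoint (A s) (A s') := by
    intro s hs s' hs' hne
    rw [Finset.disjoint_left]
    intro c hc hc'
    obtain ⟨z, z', hz⟩ := hnc s c hc
    have key : ∀ s ∈ powersetCard 2 (univ : Finset (Fin r)), c ∈ A s → ({c z, c z'} : Finset (Fin r)) = s := by
      intro s hs hc
      simp only [hA, mem_sdiff, Fintype.mem_piFinset] at hc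
      refine Finset.eq_of_subset_of_card_le ?_ ?_
      · intro a ha
        simp only [mem_insert, mem_singleton] at ha
        rcases ha with rfl | rfl
        · exact hc.1 _
        · exact hc.1 _
      · rw [card_pair hz, (mem_powersetCard.1 hs).2]
    exact hne ((key s hs hc).symm.trans (key s' hs' hc'))
  have hcc : cst.card = r := by
    rw [hcst, card_image_of_injective _ (fun a b h => congrFun h 0), card_univ, Fintype.card_fin]
  have hdc : Disjoint ((powersetCard 2 (univ : Finset (Fin r))).biUnion A) cst := by
    rw [Finset.disjoint_left]
    intro c hc hc'
    obtain ⟨s, hs, hcs⟩ := mem_biUnion.1 hc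
    obtain ⟨z, z', hz⟩ := hnc s c hcs
    simp only [hcst, mem_image, mem_univ, true_and] at hc'
    obtain ⟨j, rfl⟩ := hc'
    exact hz rfl
  have hsub : (powersetCard 2 (univ : Finset (Fin r))).biUnion A ∪ cst ⊆
      (univ.filter (fun c : ZMod n → Fin r => ∃ j k, ∀ z, c z = j ∨ c z = k)) := by
    intro c hc
    simp only [mem_filter, mem_univ, true_and]
    rcases mem_union.1 hc with hc | hc
    · obtain ⟨s, hs, hcs⟩ := mem_biUnion.1 hc
      obtain ⟨j, k, -, rfl⟩ := card_eq_two.1 (mem_powersetCard.1 hs).2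
      simp only [hA, mem_sdiff, Fintype.mem_piFinset] at hcs
      exact ⟨j, k, fun z => by simpa using hcs.1 z⟩
    · simp only [hcst, mem_image, mem_univ, true_and] at hc
      obtain ⟨j, rfl⟩ := hc
      exact ⟨j, j, fun z => Or.inl rfl⟩
  refine le_trans ?_ (card_le_card hsub)
  rw [card_union_of_disjoint hdc, hcc, card_biUnion hdisj]
  refine Nat.add_le_add_right ?_ _
  have := Finset.card_nsmul_le_sum _ _ _ hAcard
  rwa [card_powersetCard, card_univ, Fintype.card_fin, smul_eq_mul] at this

open Finset Classical in
lemma gZ_split (r n : ℕ) [NeZero n] : gZ r n =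
    (univ.filter (fun c : ZMod n → Fin r => ∃ j k, ∀ z, c z = j ∨ c z = k)).card + (Bad r n).card := by
  have h0 : gZ r n = (univ.filter (fun c : ZMod n → Fin r => RainbowAPFreeZ c)).card := by
    unfold gZ
    rw [Nat.card_eq_fintype_card, Fintype.card_subtype]
  rw [h0, ← card_union_of_disjoint]
  · congr 1
    ext c
    simp only [Bad, mem_union, mem_filter, mem_univ, true_and]
    constructor
    · intro hc
      by_cases h : ∃ j k, ∀ z, c z = j ∨ c z = k
      · exact Or.inl h
      · push Not at h
        exact Or.inr ⟨hc, h⟩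
    · rintro (⟨j, k, h⟩ | h)
      · intro x y z _ _
        rcases h x with h1 | h1 <;> rcases h y with h2 | h2 <;> rcases h z with h3 | h3 <;> simp [h1, h2, h3]
      · exact h.1
  · rw [Finset.disjoint_left]
    intro c hc hc'
    simp only [Bad, mem_filter, mem_univ, true_and] at hc hc'
    obtain ⟨j, k, h⟩ := hc
    obtain ⟨z, hz⟩ := hc'.2 j k
    exact (h z).elim hz.1 hz.2

theorem stmt_4 (r : ℕ) (hr : 3 ≤ r) :
    ∃ n₀ : ℕ, ∀ n : ℕ, n₀ ≤ n →
      (r.choose 2 : ℝ) * 2 ^ n - r ^ 2 + 2 * r ≤ (gZ r n : ℝ) ∧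
      (gZ r n : ℝ) ≤ (r.choose 2 : ℝ) * 2 ^ n +
        (2 : ℝ) ^ (-(n : ℝ) / (36 * Real.logb 2 n)) * 2 ^ n := by
  obtain ⟨δ, hδ, n₁, hn₁⟩ := bad_count r (by omega)
  obtain ⟨m, hm⟩ := exists_nat_ge (1 / (36 * δ))
  refine ⟨max n₁ (2 ^ (m + 1)), ?_⟩
  intro n hn
  obtain ⟨hnn1, hnm⟩ := max_le_iff.1 hn
  have hnpos : 0 < n := lt_of_lt_of_le (by positivity) hnm
  have : NeZero n := ⟨hnpos.ne'⟩
  have hn0 : (0 : ℝ) < n := by exact_mod_cast hnpos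
  rw [gZ_split r n]
  push_cast
  constructor
  · have h1 := (Nat.cast_le (α := ℝ)).2 (few_lower r n)
    have h2 : 2 ≤ 2 ^ n := by
      calc 2 = 2 ^ 1 := by norm_num
        _ ≤ 2 ^ n := Nat.pow_le_pow_right (by norm_num) hnpos
    rw [Nat.cast_add, Nat.cast_mul, Nat.cast_sub h2] at h1
    push_cast at h1
    have h3 : (r.choose 2 : ℝ) * 2 = r * (r - 1) := by
      rw [Nat.cast_choose_two]; ring
    have h4 : (0 : ℝ) ≤ (Bad r n).card := by positivity
    nlinarith
  · have h1 := (Nat.cast_le (α := ℝ)).2 (few_upper r n (by omega))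
    push_cast at h1
    refine add_le_add h1 ((hn₁ n hnn1).trans ?_)
    rw [← Real.rpow_natCast 2 n, ← Real.rpow_add (by norm_num)]
    apply Real.rpow_le_rpow_of_exponent_le (by norm_num)
    have hlog : (m + 1 : ℝ) ≤ Real.logb 2 n := by
      rw [Real.le_logb_iff_rpow_le (by norm_num) hn0]
      have : ((2 ^ (m + 1) : ℕ) : ℝ) ≤ n := by exact_mod_cast hnm
      rw [← Nat.cast_succ, Real.rpow_natCast]
      exact_mod_cast this
    have hm0 : (0 : ℝ) ≤ m := by positivity
    have hlpos : 0 < 36 * Real.logb 2 n := by linarith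
    have h5 : (n : ℝ) / (36 * Real.logb 2 n) ≤ δ * n := by
      rw [div_le_iff₀ hlpos]
      rw [div_le_iff₀ (by positivity)] at hm
      have : 1 ≤ δ * (36 * Real.logb 2 n) := by nlinarith
      nlinarith
    rw [neg_div]
    linarith
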